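/- Let X be a finite connected (k₁+1, k₂+1)-biregular graph with k₁ ≥ 2 and k₂ ≥ 2. Let ℓ be a normalized length function on X (so Σ_{e∈E} ℓ(e) = 2), let h > 0, and suppose there is a vector (x_e)_{e∈E} with all entries positive satisfying x_e = Σ_{f∈E} ρ_{ef} e^{−h ℓ(f)} x_f for all e ∈ E. Then h ≥ (|E|/4) log(k₁ k₂), where |E| is the number of oriented edges, and equality holds if and only if ℓ(e) = 2/|E| for every e ∈ E. -/

import Mathlib

/-- A finite graph in the sense of Serre: oriented edges with a fixed-point-free
involution `bar`, and initial/terminal vertex maps `i`, `t`. -/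
structure SerreGraph (V E : Type) where
  bar : E → E
  bar_bar : ∀ e, bar (bar e) = e
  bar_ne : ∀ e, bar e ≠ e
  i : E → V
  t : E → V
  i_bar : ∀ e, i (bar e) = t e
  t_bar : ∀ e, t (bar e) = i e

namespace SerreGraph

variable {V E : Type}

/-- `rho G e f = 1` iff `ef` is a combinatorial path without backtracking. -/
def rho [DecidableEq V] [DecidableEq E] (G : SerreGraph V E) (e f : E) : ℝ :=
  if G.t e = G.i f ∧ G.bar e ≠ f then 1 else 0

/-- The edge adjacency matrix of the graph. -/
def adjMatrix [DecidableEq V] [DecidableEq E] (G : SerreGraph V E) : Matrix E E ℝ :=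
  fun e f => G.rho e f

/-- The valency of a vertex: the number of edges with initial vertex `x`. -/
noncomputable def valency (G : SerreGraph V E) (x : V) : ℕ :=
  Nat.card {e : E // G.i e = x}

/-- `G.k x` is the valency of `x` minus one. -/
noncomputable def k (G : SerreGraph V E) (x : V) : ℕ :=
  G.valency x - 1

/-- The graph is connected: the equivalence relation on vertices generated by
relating `i e` to `t e` has a single class. -/
def Connected (G : SerreGraph V E) : Prop :=
  ∀ x y : V, Relation.EqvGen (fun a b => ∃ e : E, G.i e = a ∧ G.t e = b) x y

/-- A nonnegative square matrix is reducible if the index set splits into two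
nonempty complementary subsets with all entries between them vanishing. -/
def MatReducible (M : Matrix E E ℝ) : Prop :=
  ∃ U : Set E, U.Nonempty ∧ Uᶜ.Nonempty ∧ ∀ u ∈ U, ∀ v ∈ Uᶜ, M u v = 0 ∧ M v u = 0

/-- A matrix is irreducible if it is not reducible. -/
def MatIrreducible (M : Matrix E E ℝ) : Prop :=
  ¬ MatReducible M

/-- A length function: positive and invariant under the edge involution. -/
def IsLengthFunction (G : SerreGraph V E) (ℓ : E → ℝ) : Prop :=
  (∀ e, 0 < ℓ e) ∧ ∀ e, ℓ (G.bar e) = ℓ e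

end SerreGraph

namespace SerreGraph

variable {V E : Type}

/-- The edge involution as a permutation. -/
def barEquiv (G : SerreGraph V E) : E ≃ E where
  toFun := G.bar
  invFun := G.bar
  left_inv := G.bar_bar
  right_inv := G.bar_bar

theorem sum_comp_bar [Fintype E] (G : SerreGraph V E) (F : E → ℝ) :
    ∑ e, F (G.bar e) = ∑ e, F e :=
  Equiv.sum_comp G.barEquiv F

theorem valency_eq_card [DecidableEq V] [Fintype E] (G : SerreGraph V E) (x : V) :
    G.valency x = (Finset.univ.filter fun f => G.i f = x).card := by
  rw [valency, Nat.card_eq_fintype_card, Fintype.card_subtype]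

variable [DecidableEq V] [DecidableEq E]

theorem rho_bar_bar (G : SerreGraph V E) (e f : E) :
    G.rho (G.bar f) (G.bar e) = G.rho e f := by
  unfold rho
  rw [G.t_bar, G.i_bar, G.bar_bar]
  congr 1
  apply propext
  constructor
  · rintro ⟨h1, h2⟩
    exact ⟨h1.symm, fun h => h2 h.symm⟩
  · rintro ⟨h1, h2⟩
    exact ⟨h1.symm, fun h => h2 h.symm⟩

theorem rho_nonneg (G : SerreGraph V E) (e f : E) : 0 ≤ G.rho e f := by
  unfold rho
  split_ifs <;> norm_num

theorem eq_of_rho_ne_zero (G : SerreGraph V E) {e f : E} (hef : G.rho e f ≠ 0) :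
    G.t e = G.i f := by
  by_contra hne
  exact hef (by simp [rho, hne])

/-- Against `rho e f`, a function of the vertices may be evaluated at `t e` or at `i f`. -/
theorem rho_mul_comp_t (G : SerreGraph V E) (F : V → ℝ) (e f : E) :
    G.rho e f * F (G.t e) = G.rho e f * F (G.i f) := by
  by_cases hef : G.rho e f = 0
  · simp [hef]
  · rw [G.eq_of_rho_ne_zero hef]

/-- The Jensen gap `u - 1 - log u` at `u = k(t e) z_f / x_e`, weighted by the uniform transition
probabilities `rho e f / k(t e)`. -/
noncomputable def gap (G : SerreGraph V E) (x z : E → ℝ) (e f : E) : ℝ :=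
  G.rho e f * (G.k (G.t e) : ℝ)⁻¹ *
    (G.k (G.t e) * z f / x e - 1 - Real.log (G.k (G.t e) * z f / x e))

theorem gap_nonneg (G : SerreGraph V E) (hk : ∀ v, 0 < G.k v) {x z : E → ℝ}
    (hx : ∀ e, 0 < x e) (hz : ∀ e, 0 < z e) (e f : E) : 0 ≤ G.gap x z e f := by
  have hk' : (0 : ℝ) < G.k (G.t e) := by exact_mod_cast hk _
  have hu : 0 < G.k (G.t e) * z f / x e := div_pos (mul_pos hk' (hz f)) (hx e)
  have := Real.log_le_sub_one_of_pos hu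
  exact mul_nonneg (mul_nonneg (G.rho_nonneg e f) (inv_nonneg.2 hk'.le)) (by linarith)

theorem eq_of_gap_eq_zero (G : SerreGraph V E) (hk : ∀ v, 0 < G.k v) {x z : E → ℝ}
    (hx : ∀ e, 0 < x e) (hz : ∀ e, 0 < z e) {e f : E} (hef : G.rho e f = 1)
    (hgap : G.gap x z e f = 0) : G.k (G.t e) * z f = x e := by
  have hk' : (0 : ℝ) < G.k (G.t e) := by exact_mod_cast hk _
  have hu : 0 < G.k (G.t e) * z f / x e := div_pos (mul_pos hk' (hz f)) (hx e)
  rw [gap, hef, one_mul, mul_eq_zero] at hgap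
  have hlog := hgap.resolve_left (inv_ne_zero hk'.ne')
  by_contra hne
  have hu1 : G.k (G.t e) * z f / x e ≠ 1 := fun h1 => hne ((div_eq_one_iff_eq (hx e).ne').1 h1)
  have := Real.log_lt_sub_one_of_pos hu hu1
  linarith

variable [Fintype E]

/-- The number of edges that can follow `e` without backtracking. -/
theorem sum_rho_right (G : SerreGraph V E) (e : E) : ∑ f, G.rho e f = G.k (G.t e) := by
  have hset : (Finset.univ.filter fun f => G.t e = G.i f ∧ G.bar e ≠ f) =
      (Finset.univ.filter fun f => G.i f = G.t e).erase (G.bar e) := by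
    ext f
    simp only [Finset.mem_filter, Finset.mem_univ, true_and, Finset.mem_erase]
    constructor
    · rintro ⟨h1, h2⟩
      exact ⟨h2.symm, h1.symm⟩
    · rintro ⟨h1, h2⟩
      exact ⟨h2.symm, h1.symm⟩
  simp only [rho, Finset.sum_boole]
  rw [hset, Finset.card_erase_of_mem (by simp [G.i_bar]), k, valency_eq_card]

/-- The number of edges that can precede `f` without backtracking. -/
theorem sum_rho_left (G : SerreGraph V E) (f : E) : ∑ e, G.rho e f = G.k (G.i f) := by
  rw [← G.sum_comp_bar]
  simp_rw [← fun e => G.rho_bar_bar (G.bar e) f, G.bar_bar]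
  rw [G.sum_rho_right, G.t_bar]

/-- Two edges leaving a common vertex of valency at least `3` can both follow some edge. -/
theorem exists_rho_eq_one (G : SerreGraph V E) {f g : E} (hfg : G.i f = G.i g)
    (hk : 2 ≤ G.k (G.i f)) : ∃ e, G.t e = G.i f ∧ G.rho e f = 1 ∧ G.rho e g = 1 := by
  have hcard : ({f, g} : Finset E).card < (Finset.univ.filter fun a => G.i a = G.i f).card := by
    have h2 := Finset.card_le_two (a := f) (b := g)
    rw [k, valency_eq_card] at hk
    omega
  obtain ⟨a, ha, ha'⟩ := Finset.exists_mem_notMem_of_card_lt_card hcard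
  simp only [Finset.mem_filter, Finset.mem_univ, true_and] at ha
  simp only [Finset.mem_insert, Finset.mem_singleton, not_or] at ha'
  refine ⟨G.bar a, ?_, ?_, ?_⟩
  · rw [G.t_bar, ha]
  · rw [rho, if_pos ⟨by rw [G.t_bar, ha], by rw [G.bar_bar]; exact ha'.1⟩]
  · rw [rho, if_pos ⟨by rw [G.t_bar, ha, hfg], by rw [G.bar_bar]; exact ha'.2⟩]

theorem sum_gap (G : SerreGraph V E) (hk : ∀ v, 0 < G.k v) {x z : E → ℝ}
    (hx : ∀ e, 0 < x e) (hz : ∀ e, 0 < z e) (hsys : ∀ e, x e = ∑ f, G.rho e f * z f) :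
    ∑ e, ∑ f, G.gap x z e f =
      ∑ e, Real.log (x e) - ∑ e, Real.log (G.k (G.t e)) - ∑ f, Real.log (z f) := by
  have hk' : ∀ v, (0 : ℝ) < G.k v := fun v => by exact_mod_cast hk v
  have hrow : ∀ e, ∑ f, G.gap x z e f = Real.log (x e) - Real.log (G.k (G.t e)) -
      ∑ f, G.rho e f * ((G.k (G.t e) : ℝ)⁻¹ * Real.log (z f)) := by
    intro e
    have hterm : ∀ f, G.gap x z e f = (x e)⁻¹ * (G.rho e f * z f) +
        (G.k (G.t e) : ℝ)⁻¹ * (Real.log (x e) - Real.log (G.k (G.t e)) - 1) * G.rho e f -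
        G.rho e f * ((G.k (G.t e) : ℝ)⁻¹ * Real.log (z f)) := by
      intro f
      have h1 := (hk' (G.t e)).ne'
      have h2 := (hx e).ne'
      rw [gap, Real.log_div (mul_pos (hk' _) (hz f)).ne' h2, Real.log_mul h1 (hz f).ne']
      field_simp
      ring
    rw [Finset.sum_congr rfl fun f _ => hterm f, Finset.sum_sub_distrib, Finset.sum_add_distrib,
      ← Finset.mul_sum, ← Finset.mul_sum, ← hsys, sum_rho_right]
    have h1 := (hk' (G.t e)).ne'
    have h2 := (hx e).ne'
    field_simp
    ring
  have hcol : ∀ f, ∑ e, G.rho e f * ((G.k (G.t e) : ℝ)⁻¹ * Real.log (z f)) = Real.log (z f) := by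
    intro f
    rw [Finset.sum_congr rfl fun e _ =>
      G.rho_mul_comp_t (fun v => (G.k v : ℝ)⁻¹ * Real.log (z f)) e f,
      ← Finset.sum_mul, sum_rho_left]
    have h1 := (hk' (G.i f)).ne'
    field_simp
  rw [Finset.sum_congr rfl fun e _ => hrow e, Finset.sum_sub_distrib, Finset.sum_sub_distrib,
    Finset.sum_comm, Finset.sum_congr rfl fun f _ => hcol f]

/-- The total Jensen gap of a solution of the entropy system. -/
theorem sum_gap_entropy (G : SerreGraph V E) (hk : ∀ v, 0 < G.k v) {x ℓ : E → ℝ} {h : ℝ}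
    (hx : ∀ e, 0 < x e) (hsys : ∀ e, x e = ∑ f, G.rho e f * Real.exp (-h * ℓ f) * x f) :
    ∑ e, ∑ f, G.gap x (fun f => Real.exp (-h * ℓ f) * x f) e f =
      h * ∑ e, ℓ e - ∑ e, Real.log (G.k (G.t e)) := by
  rw [G.sum_gap hk hx (fun e => mul_pos (Real.exp_pos _) (hx e))
    (fun e => by simpa only [mul_assoc] using hsys e)]
  have hlog : ∀ f, Real.log (Real.exp (-h * ℓ f) * x f) = -h * ℓ f + Real.log (x f) := fun f => by
    rw [Real.log_mul (Real.exp_pos _).ne' (hx f).ne', Real.log_exp]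
  simp only [hlog, Finset.sum_add_distrib, ← Finset.mul_sum]
  ring

/-- If the Jensen gap vanishes, every edge length is determined by the valencies of its ends. -/
theorem two_mul_length_eq_log (G : SerreGraph V E) (hk : ∀ v, 2 ≤ G.k v) {x ℓ : E → ℝ} {h : ℝ}
    (hℓ : G.IsLengthFunction ℓ) (hx : ∀ e, 0 < x e)
    (hgap : ∀ e f, G.gap x (fun f => Real.exp (-h * ℓ f) * x f) e f = 0) (e : E) :
    2 * (h * ℓ e) = Real.log (G.k (G.i e) * G.k (G.t e)) := by
  have hk0 : ∀ v, 0 < G.k v := fun v => by have := hk v; omega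
  have hz : ∀ e, 0 < Real.exp (-h * ℓ e) * x e := fun e => mul_pos (Real.exp_pos _) (hx e)
  have hk' : ∀ v, (0 : ℝ) < G.k v := fun v => by exact_mod_cast hk0 v
  have hconst : ∀ f g, G.i f = G.i g →
      Real.exp (-h * ℓ f) * x f = Real.exp (-h * ℓ g) * x g := by
    intro f g hfg
    obtain ⟨a, -, haf, hag⟩ := G.exists_rho_eq_one hfg (hk _)
    have h1 := G.eq_of_gap_eq_zero hk0 hx hz haf (hgap a f)
    have h2 := G.eq_of_gap_eq_zero hk0 hx hz hag (hgap a g)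
    exact mul_left_cancel₀ (hk' (G.t a)).ne' (h1.trans h2.symm)
  have hstep : ∀ a, x a = G.k (G.t a) * (Real.exp (-h * ℓ a) * x (G.bar a)) := by
    intro a
    have hne : G.k (G.t a) ≠ 0 := (hk0 _).ne'
    have hsum : ∑ f, G.rho a f ≠ 0 := by
      rw [G.sum_rho_right]
      exact_mod_cast hne
    obtain ⟨f, -, hf⟩ := Finset.exists_ne_zero_of_sum_ne_zero hsum
    have hf1 : G.rho a f = 1 := by
      unfold rho at hf ⊢
      split_ifs at hf ⊢ <;> simp_all
    have hxa := G.eq_of_gap_eq_zero hk0 hx hz hf1 (hgap a f)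
    have hzf := hconst f (G.bar a) (by rw [G.i_bar, G.eq_of_rho_ne_zero hf])
    rw [hℓ.2] at hzf
    rw [← hzf, hxa]
  have h1 := hstep e
  have h2 := hstep (G.bar e)
  rw [G.bar_bar, G.t_bar, hℓ.2] at h2
  have h1' : Real.log (x e) = _ := congrArg Real.log h1
  have h2' : Real.log (x (G.bar e)) = _ := congrArg Real.log h2
  rw [Real.log_mul (hk' _).ne' (mul_pos (Real.exp_pos _) (hx _)).ne',
    Real.log_mul (Real.exp_pos _).ne' (hx _).ne', Real.log_exp] at h1' h2'
  rw [Real.log_mul (hk' _).ne' (hk' _).ne']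
  linarith

/-- The entropy for a constant length function, when `k(i e) * k(t e)` is constant. -/
theorem two_mul_entropy_eq_log [Nonempty E] (G : SerreGraph V E) (hk : ∀ v, 0 < G.k v) {K : ℝ}
    (hK : ∀ e, (G.k (G.i e) * G.k (G.t e) : ℝ) = K) {x : E → ℝ} {s : ℝ} (hx : ∀ e, 0 < x e)
    (hsys : ∀ e, x e = ∑ f, G.rho e f * Real.exp (-s) * x f) : 2 * s = Real.log K := by
  have hk' : ∀ v, (0 : ℝ) < G.k v := fun v => by exact_mod_cast hk v
  obtain ⟨e₀⟩ := ‹Nonempty E›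
  have hKpos : 0 < K := by
    rw [← hK e₀]
    exact mul_pos (hk' _) (hk' _)
  have hleft : ∀ f, ∑ e, √(G.k (G.i e)) * G.rho e f = √K * √(G.k (G.i f)) := by
    intro f
    have hw : ∀ e, √(G.k (G.i e)) * G.rho e f = G.rho e f * (√K / √(G.k (G.i f))) := by
      intro e
      rw [← G.rho_mul_comp_t (fun v => √K / √(G.k v)), ← hK e, Real.sqrt_mul (hk' _).le,
        mul_div_cancel_right₀ _ (Real.sqrt_pos.2 (hk' _)).ne', mul_comm]
    rw [Finset.sum_congr rfl fun e _ => hw e, ← Finset.sum_mul, G.sum_rho_left]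
    have hs := Real.mul_self_sqrt (hk' (G.i f)).le
    have hs' := (Real.sqrt_pos.2 (hk' (G.i f))).ne'
    field_simp
    linarith
  set S := ∑ e, √(G.k (G.i e)) * x e with hS
  have hSpos : 0 < S :=
    Finset.sum_pos (fun e _ => mul_pos (Real.sqrt_pos.2 (hk' _)) (hx e)) ⟨e₀, Finset.mem_univ _⟩
  have hfix : S = Real.exp (-s) * √K * S := by
    calc S = ∑ e, ∑ f, √(G.k (G.i e)) * (G.rho e f * Real.exp (-s) * x f) := by
          rw [hS]
          exact Finset.sum_congr rfl fun e _ => by rw [← Finset.mul_sum, ← hsys]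
      _ = ∑ f, (∑ e, √(G.k (G.i e)) * G.rho e f) * (Real.exp (-s) * x f) := by
          rw [Finset.sum_comm]
          refine Finset.sum_congr rfl fun f _ => ?_
          rw [Finset.sum_mul]
          exact Finset.sum_congr rfl fun e _ => by ring
      _ = Real.exp (-s) * √K * S := by
          rw [hS, Finset.mul_sum]
          exact Finset.sum_congr rfl fun f _ => by rw [hleft]; ring
  have hone : Real.exp (-s) * √K = 1 :=
    mul_right_cancel₀ hSpos.ne' (by rw [← hfix, one_mul])
  have hlog := congrArg Real.log hone
  rw [Real.log_mul (Real.exp_pos _).ne' (Real.sqrt_pos.2 hKpos).ne', Real.log_exp,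
    Real.log_sqrt hKpos.le, Real.log_one] at hlog
  linarith

end SerreGraph

open SerreGraph in
/-- Biregular case: for a finite connected `(k₁+1, k₂+1)`-biregular graph with
`k₁, k₂ ≥ 2`, any `h > 0` solving the entropy system for a normalized length
function `ℓ` satisfies `h ≥ (|E|/4) log(k₁ k₂)`, with equality iff all the edges
have the same length `2/|E|`. -/
theorem entropy_biregular
    {V E : Type} [Fintype V] [Fintype E] [DecidableEq V] [DecidableEq E]
    (G : SerreGraph V E) (hconn : G.Connected)
    (k₁ k₂ : ℕ) (hk₁ : 2 ≤ k₁) (hk₂ : 2 ≤ k₂)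
    (V₁ V₂ : Set V) (hpart : ∀ x : V, (x ∈ V₁ ∨ x ∈ V₂) ∧ ¬(x ∈ V₁ ∧ x ∈ V₂))
    (hbip : ∀ e : E, (G.i e ∈ V₁ ∧ G.t e ∈ V₂) ∨ (G.i e ∈ V₂ ∧ G.t e ∈ V₁))
    (hval₁ : ∀ x ∈ V₁, G.valency x = k₁ + 1)
    (hval₂ : ∀ x ∈ V₂, G.valency x = k₂ + 1)
    (ℓ : E → ℝ) (hℓ : G.IsLengthFunction ℓ) (hnorm : ∑ e : E, ℓ e = 2)
    (h : ℝ) (hpos : 0 < h)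
    (hx : ∃ x : E → ℝ, (∀ e, 0 < x e) ∧
      ∀ e : E, x e = ∑ f : E, G.rho e f * Real.exp (-h * ℓ f) * x f) :
    h ≥ ((Fintype.card E : ℝ) / 4) * Real.log ((k₁ : ℝ) * (k₂ : ℝ)) ∧
      (h = ((Fintype.card E : ℝ) / 4) * Real.log ((k₁ : ℝ) * (k₂ : ℝ)) ↔
        ∀ e : E, ℓ e = 2 / (Fintype.card E : ℝ)) := by
  obtain ⟨x, hxpos, hsys⟩ := hx
  have hkv₁ : ∀ v ∈ V₁, G.k v = k₁ := fun v hv => by rw [SerreGraph.k, hval₁ v hv]; rfl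
  have hkv₂ : ∀ v ∈ V₂, G.k v = k₂ := fun v hv => by rw [SerreGraph.k, hval₂ v hv]; rfl
  have hk : ∀ v, 2 ≤ G.k v := fun v => by
    rcases (hpart v).1 with hv | hv
    · rwa [hkv₁ v hv]
    · rwa [hkv₂ v hv]
  have hk0 : ∀ v, 0 < G.k v := fun v => by have := hk v; omega
  have hk' : ∀ v, (0 : ℝ) < G.k v := fun v => by exact_mod_cast hk0 v
  have hK : ∀ e, (G.k (G.i e) * G.k (G.t e) : ℝ) = (k₁ : ℝ) * k₂ := fun e => by
    rcases hbip e with ⟨hi, ht⟩ | ⟨hi, ht⟩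
    · rw [hkv₁ _ hi, hkv₂ _ ht]
    · rw [hkv₂ _ hi, hkv₁ _ ht, mul_comm]
  have hlog : ∑ e, Real.log (G.k (G.t e)) =
      (Fintype.card E : ℝ) / 2 * Real.log ((k₁ : ℝ) * k₂) := by
    have hbar := G.sum_comp_bar fun e => Real.log (G.k (G.t e))
    simp only [G.t_bar] at hbar
    have hsum : ∑ e, (Real.log (G.k (G.i e)) + Real.log (G.k (G.t e))) =
        (Fintype.card E : ℝ) * Real.log ((k₁ : ℝ) * k₂) := by
      rw [Finset.sum_congr rfl fun e _ => by
        rw [← Real.log_mul (hk' _).ne' (hk' _).ne', hK e]]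
      simp
    rw [Finset.sum_add_distrib] at hsum
    linarith
  have : Nonempty E := by
    by_contra hE
    rw [not_nonempty_iff] at hE
    simp at hnorm
  have hcard : (0 : ℝ) < Fintype.card E := by exact_mod_cast Fintype.card_pos
  have hgap := G.sum_gap_entropy hk0 hxpos hsys
  rw [hnorm, hlog] at hgap
  have hnonneg := G.gap_nonneg hk0 hxpos (z := fun f => Real.exp (-h * ℓ f) * x f)
    (fun e => mul_pos (Real.exp_pos _) (hxpos e))
  have htotal := Finset.sum_nonneg fun e (_ : e ∈ Finset.univ) =>
    Finset.sum_nonneg fun f (_ : f ∈ Finset.univ) => hnonneg e f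
  refine ⟨by linarith, fun heq e => ?_, fun hconst => ?_⟩
  · have hzero : ∀ e f, G.gap x (fun f => Real.exp (-h * ℓ f) * x f) e f = 0 := by
      have hsum0 : ∑ e, ∑ f, G.gap x (fun f => Real.exp (-h * ℓ f) * x f) e f = 0 := by
        rw [hgap]
        linarith
      intro e f
      have hrow := (Finset.sum_eq_zero_iff_of_nonneg fun e _ =>
        Finset.sum_nonneg fun f _ => hnonneg e f).1 hsum0 e (Finset.mem_univ _)
      exact (Finset.sum_eq_zero_iff_of_nonneg fun f _ => hnonneg e f).1 hrow f (Finset.mem_univ _)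
    have hlen := G.two_mul_length_eq_log hk hℓ hxpos hzero e
    rw [hK e] at hlen
    rw [← hlen] at heq
    rw [eq_div_iff hcard.ne']
    refine mul_left_cancel₀ hpos.ne' ?_
    linarith
  · have hs := G.two_mul_entropy_eq_log hk0 hK hxpos (s := h * (2 / (Fintype.card E : ℝ)))
      fun e => by simpa only [hconst, neg_mul] using hsys e
    rw [← hs]
    field_simp
    ring
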